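/- Let 𝒞 ⊆ (ℤ/2)^{2n} be a doubly-even self-dual code with respect to η which is F₄-even, with n ∈ 4ℤ. Let χ := (1/√2)·1_{2n} ∈ Λ(𝒞), δ := χ/2 = (1/(2√2))·1_{2n}, Λ₀ := {λ ∈ Λ(𝒞) : χ ⊙ λ ∈ 2ℤ}, Λ₁ := {λ ∈ Λ(𝒞) : χ ⊙ λ ∈ 2ℤ+1}; set Λ₂ := Λ₁ + δ and Λ₃ := Λ₀ + δ if n ∈ 8ℤ, and Λ₂ := Λ₀ + δ and Λ₃ := Λ₁ + δ if n ∈ 8ℤ+4. Then for every τ in the upper half-plane: Θ_{Λ₂}(τ) = ½[W_𝒞({ψ̃⁺_{ab}}) − W_𝒞({ψ̃⁻_{ab}})] and Θ_{Λ₃}(τ) = ½[W_𝒞({ψ̃⁺_{ab}}) + W_𝒞({ψ̃⁻_{ab}})], where, with ã, b̃ ∈ {0,1} the lifts of a, b ∈ ℤ/2, ψ̃⁺_{ab} := Θ_{ã+b̃+1,2}Θ̄_{ã−b̃,2} + Θ_{ã+b̃−1,2}Θ̄_{ã−b̃−2,2} and ψ̃⁻_{ab} := e^{πi(ã+1/2)(b̃+1/2)}(Θ_{ã+b̃+1,2}Θ̄_{ã−b̃,2}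 − Θ_{ã+b̃−1,2}Θ̄_{ã−b̃−2,2}). -/

import Mathlib

noncomputable section
open scoped BigOperators

/-- The Lorentzian inner product `x ⊙ y = Σᵢ (xᵢ y_{n+i} + x_{n+i} yᵢ)` on `ℝ^{2n}`,
with coordinates indexed by `Fin n ⊕ Fin n` (metric `η = [[0,Iₙ],[Iₙ,0]]`). -/
def lorR {n : ℕ} (x y : Fin n ⊕ Fin n → ℝ) : ℝ :=
  ∑ i : Fin n, (x (Sum.inl i) * y (Sum.inr i) + x (Sum.inr i) * y (Sum.inl i))

/-- The Lorentzian inner product on `(ℤ/p)^{2n}`. -/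
def lorZmod {n p : ℕ} (x y : Fin n ⊕ Fin n → ZMod p) : ZMod p :=
  ∑ i : Fin n, (x (Sum.inl i) * y (Sum.inr i) + x (Sum.inr i) * y (Sum.inl i))

/-- The componentwise lift of a codeword in `(ℤ/p)^{2n}` to `{0,…,p−1}^{2n} ⊆ ℝ^{2n}`. -/
def liftR {n p : ℕ} (c : Fin n ⊕ Fin n → ZMod p) : Fin n ⊕ Fin n → ℝ :=
  fun i => ((c i).val : ℝ)

/-- The Construction A lattice `Λ(𝒞) = {(c̃ + p·m)/√p : c ∈ 𝒞, m ∈ ℤ^{2n}} ⊆ ℝ^{2n}`. -/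
def constrA {n : ℕ} (p : ℕ) (C : Set (Fin n ⊕ Fin n → ZMod p)) : Set (Fin n ⊕ Fin n → ℝ) :=
  {x | ∃ c ∈ C, ∃ m : Fin n ⊕ Fin n → ℤ, x = fun i => (liftR c i + p * m i) / Real.sqrt p}

/-- The dual `L* = {x : x ⊙ l ∈ ℤ for all l ∈ L}` with respect to the Lorentzian
inner product. -/
def dualLor {n : ℕ} (L : Set (Fin n ⊕ Fin n → ℝ)) : Set (Fin n ⊕ Fin n → ℝ) :=
  {x | ∀ l ∈ L, ∃ k : ℤ, lorR x l = (k : ℝ)}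

/-- `q^x := e^{2πiτx}` for real `x`. -/
def qpow (τ : ℂ) (x : ℝ) : ℂ := Complex.exp (2 * Real.pi * Complex.I * τ * x)

/-- `q̄^x := e^{−2πi·conj(τ)·x}` for real `x`. -/
def qbarpow (τ : ℂ) (x : ℝ) : ℂ :=
  Complex.exp (-(2 * Real.pi * Complex.I) * (starRingEnd ℂ τ) * x)

/-- The theta function `Θ_S(τ) = Σ_{λ∈S} q^{|λ₁+λ₂|²/4} q̄^{|λ₁−λ₂|²/4}` of a subset
`S ⊆ ℝ^{2n}`, where `λ = (λ₁, λ₂)`. -/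
def thetaSet {n : ℕ} (S : Set (Fin n ⊕ Fin n → ℝ)) (τ : ℂ) : ℂ :=
  ∑' l : S,
    qpow τ ((∑ i : Fin n, (l.1 (Sum.inl i) + l.1 (Sum.inr i)) ^ 2) / 4) *
      qbarpow τ ((∑ i : Fin n, (l.1 (Sum.inl i) - l.1 (Sum.inr i)) ^ 2) / 4)

/-- The complete weight enumerator `W_𝒞({x_{ab}}) = Σ_{(α,β)∈𝒞} Πᵢ x_{αᵢβᵢ}` of a code
`𝒞 ⊆ (ℤ/p)^{2n}`, evaluated on a family of complex numbers `x`. -/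
def cwe {n p : ℕ} (C : Set (Fin n ⊕ Fin n → ZMod p)) (x : ZMod p → ZMod p → ℂ) : ℂ :=
  ∑' c : C, ∏ i : Fin n, x (c.1 (Sum.inl i)) (c.1 (Sum.inr i))

/-- The theta function `Θ_{m,k}(τ) = Σ_{n∈ℤ} q^{k(n+m/(2k))²}`. -/
def thetaMK (m : ℤ) (k : ℕ) (τ : ℂ) : ℂ :=
  ∑' j : ℤ, qpow τ ((k : ℝ) * ((j : ℝ) + (m : ℝ) / (2 * (k : ℝ))) ^ 2)

/-- The conjugate theta function `Θ̄_{m,k}(τ) = Σ_{n∈ℤ} q̄^{k(n+m/(2k))²}`. -/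
def thetaMKbar (m : ℤ) (k : ℕ) (τ : ℂ) : ℂ :=
  ∑' j : ℤ, qbarpow τ ((k : ℝ) * ((j : ℝ) + (m : ℝ) / (2 * (k : ℝ))) ^ 2)

/-- `Λ₀ = {λ ∈ L : χ ⊙ λ ∈ 2ℤ}`. -/
def lam0 {n : ℕ} (L : Set (Fin n ⊕ Fin n → ℝ)) (χ : Fin n ⊕ Fin n → ℝ) :
    Set (Fin n ⊕ Fin n → ℝ) :=
  {l ∈ L | ∃ k : ℤ, lorR χ l = 2 * (k : ℝ)}

/-- `Λ₁ = {λ ∈ L : χ ⊙ λ ∈ 2ℤ+1}`. -/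
def lam1 {n : ℕ} (L : Set (Fin n ⊕ Fin n → ℝ)) (χ : Fin n ⊕ Fin n → ℝ) :
    Set (Fin n ⊕ Fin n → ℝ) :=
  {l ∈ L | ∃ k : ℤ, lorR χ l = 2 * (k : ℝ) + 1}

/-- The shift `S + v` of a subset `S ⊆ ℝ^{2n}` by the vector `v`. -/
def shiftSet {n : ℕ} (S : Set (Fin n ⊕ Fin n → ℝ)) (v : Fin n ⊕ Fin n → ℝ) :
    Set (Fin n ⊕ Fin n → ℝ) :=
  (· + v) '' S

/-- A binary code `𝒞 ⊆ (ℤ/2)^{2n}` is F₄-even if every codeword `c = (α, β)` satisfies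
`α̃·α̃ + β̃·β̃ − α̃·β̃ ∈ 2ℤ`, where `α̃, β̃ ∈ {0,1}^n` are the integer lifts. -/
def isF4Even {n : ℕ} (C : Set (Fin n ⊕ Fin n → ZMod 2)) : Prop :=
  ∀ c ∈ C, (2 : ℤ) ∣ ∑ i : Fin n,
    (((c (Sum.inl i)).val : ℤ) * ((c (Sum.inl i)).val : ℤ)
      + ((c (Sum.inr i)).val : ℤ) * ((c (Sum.inr i)).val : ℤ)
      - ((c (Sum.inl i)).val : ℤ) * ((c (Sum.inr i)).val : ℤ))

/-- A binary code `𝒞 ⊆ (ℤ/2)^{2n}` is doubly-even with respect to `η` if the integer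
lift of every codeword satisfies `c̃ ⊙ c̃ ∈ 4ℤ`. -/
def isDoublyEven {n : ℕ} (C : Set (Fin n ⊕ Fin n → ZMod 2)) : Prop :=
  ∀ c ∈ C, (4 : ℤ) ∣ ∑ i : Fin n,
    (((c (Sum.inl i)).val : ℤ) * ((c (Sum.inr i)).val : ℤ)
      + ((c (Sum.inr i)).val : ℤ) * ((c (Sum.inl i)).val : ℤ))

/-- `ψ̃⁺_{ab} = Θ_{ã+b̃+1,2}Θ̄_{ã−b̃,2} + Θ_{ã+b̃−1,2}Θ̄_{ã−b̃−2,2}`. -/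
def psiTP2 (a b : ZMod 2) (τ : ℂ) : ℂ :=
  thetaMK ((a.val : ℤ) + (b.val : ℤ) + 1) 2 τ * thetaMKbar ((a.val : ℤ) - (b.val : ℤ)) 2 τ
    + thetaMK ((a.val : ℤ) + (b.val : ℤ) - 1) 2 τ
        * thetaMKbar ((a.val : ℤ) - (b.val : ℤ) - 2) 2 τ

/-- `ψ̃⁻_{ab} = e^{πi(ã+1/2)(b̃+1/2)}(Θ_{ã+b̃+1,2}Θ̄_{ã−b̃,2} − Θ_{ã+b̃−1,2}Θ̄_{ã−b̃−2,2})`. -/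
def psiTM2 (a b : ZMod 2) (τ : ℂ) : ℂ :=
  Complex.exp (Real.pi * Complex.I * (((a.val : ℝ) + 1 / 2) * ((b.val : ℝ) + 1 / 2))) *
    (thetaMK ((a.val : ℤ) + (b.val : ℤ) + 1) 2 τ * thetaMKbar ((a.val : ℤ) - (b.val : ℤ)) 2 τ
      - thetaMK ((a.val : ℤ) + (b.val : ℤ) - 1) 2 τ
          * thetaMKbar ((a.val : ℤ) - (b.val : ℤ) - 2) 2 τ)

lemma norm_qpow (τ : ℂ) (x : ℝ) : ‖qpow τ x‖ = Real.exp (-Real.pi * x * (2 * τ.im)) := by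
  rw [qpow, Complex.norm_exp]
  congr 1
  simp
  ring

lemma norm_qbarpow (τ : ℂ) (x : ℝ) : ‖qbarpow τ x‖ = Real.exp (-Real.pi * x * (2 * τ.im)) := by
  rw [qbarpow, Complex.norm_exp]
  congr 1
  simp
  ring

lemma qpow_add (τ : ℂ) (x y : ℝ) : qpow τ (x + y) = qpow τ x * qpow τ y := by
  rw [qpow, qpow, qpow, ← Complex.exp_add]
  push_cast
  ring_nf

lemma qbarpow_add (τ : ℂ) (x y : ℝ) : qbarpow τ (x + y) = qbarpow τ x * qbarpow τ y := by
  rw [qbarpow, qbarpow, qbarpow, ← Complex.exp_add]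
  push_cast
  ring_nf

lemma qpow_sum {ι : Type*} (τ : ℂ) (s : Finset ι) (f : ι → ℝ) :
    qpow τ (∑ i ∈ s, f i) = ∏ i ∈ s, qpow τ (f i) := by
  induction s using Finset.cons_induction with
  | empty => simp [qpow]
  | cons a s ha ih => rw [Finset.sum_cons, Finset.prod_cons, qpow_add, ih]

lemma qbarpow_sum {ι : Type*} (τ : ℂ) (s : Finset ι) (f : ι → ℝ) :
    qbarpow τ (∑ i ∈ s, f i) = ∏ i ∈ s, qbarpow τ (f i) := by
  induction s using Finset.cons_induction with
  | empty => simp [qbarpow]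
  | cons a s ha ih => rw [Finset.sum_cons, Finset.prod_cons, qbarpow_add, ih]

lemma summable_exp_shifted_sq {τ : ℂ} (hτ : 0 < τ.im) (m : ℤ) :
    Summable fun j : ℤ =>
      Real.exp (-Real.pi * (2 * ((j : ℝ) + (m : ℝ) / (2 * 2)) ^ 2) * (2 * τ.im)) := by
  refine (HurwitzKernelBounds.summable_f_int 0 ((m : ℝ) / (2 * 2))
    (t := 4 * τ.im) (by positivity)).congr fun j => ?_
  rw [HurwitzKernelBounds.f_int, pow_zero, one_mul]
  ring_nf

lemma summable_norm_qpow_two {τ : ℂ} (hτ : 0 < τ.im) (m : ℤ) :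
    Summable fun j : ℤ =>
      ‖qpow τ (((2 : ℕ) : ℝ) * ((j : ℝ) + (m : ℝ) / (2 * ((2 : ℕ) : ℝ))) ^ 2)‖ := by
  simpa only [norm_qpow, Nat.cast_ofNat] using summable_exp_shifted_sq hτ m

lemma summable_norm_qbarpow_two {τ : ℂ} (hτ : 0 < τ.im) (m : ℤ) :
    Summable fun j : ℤ =>
      ‖qbarpow τ (((2 : ℕ) : ℝ) * ((j : ℝ) + (m : ℝ) / (2 * ((2 : ℕ) : ℝ))) ^ 2)‖ := by
  simpa only [norm_qbarpow, Nat.cast_ofNat] using summable_exp_shifted_sq hτ m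

lemma hasSum_thetaMK_mul_thetaMKbar {τ : ℂ} (hτ : 0 < τ.im) (m m' : ℤ) :
    HasSum (fun p : ℤ × ℤ =>
      qpow τ (((2 : ℕ) : ℝ) * ((p.1 : ℝ) + (m : ℝ) / (2 * ((2 : ℕ) : ℝ))) ^ 2) *
        qbarpow τ (((2 : ℕ) : ℝ) * ((p.2 : ℝ) + (m' : ℝ) / (2 * ((2 : ℕ) : ℝ))) ^ 2))
      (thetaMK m 2 τ * thetaMKbar m' 2 τ) := by
  rw [thetaMK, thetaMKbar, tsum_mul_tsum_of_summable_norm (summable_norm_qpow_two hτ m)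
    (summable_norm_qbarpow_two hτ m')]
  exact (summable_mul_of_summable_norm (summable_norm_qpow_two hτ m)
    (summable_norm_qbarpow_two hτ m')).hasSum

/-- The contribution of a single coordinate pair with code letters `a, b` and integer
translation `m` to the theta function of the shifted Construction A lattice. -/
def siteTerm (τ : ℂ) (a b : ZMod 2) (m : ℤ × ℤ) : ℂ :=
  qpow τ (((m.1 : ℝ) + m.2 + ((a.val : ℝ) + b.val + 1) / 2) ^ 2 / 2) *
    qbarpow τ (((m.1 : ℝ) - m.2 + ((a.val : ℝ) - b.val) / 2) ^ 2 / 2)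

/-- Pairs of integers, split by the parity of their sum and parametrized by half-sum and
half-difference. -/
def sumDiffEquiv : (ℤ × ℤ) ⊕ (ℤ × ℤ) ≃ ℤ × ℤ where
  toFun := Sum.elim (fun p => (p.1 + p.2 - 1, p.1 - p.2)) (fun p => (p.1 + p.2, p.1 - p.2))
  invFun m := if (m.1 + m.2) % 2 = 0 then Sum.inr ((m.1 + m.2) / 2, (m.1 - m.2) / 2)
    else Sum.inl ((m.1 + m.2 + 1) / 2, (m.1 - m.2 + 1) / 2)
  left_inv := by
    rintro (⟨x, y⟩ | ⟨x, y⟩)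
    · have h : ¬ (x + y - 1 + (x - y)) % 2 = 0 := by omega
      simp only [Sum.elim_inl, h, if_false, Sum.inl.injEq, Prod.mk.injEq]
      omega
    · have h : (x + y + (x - y)) % 2 = 0 := by omega
      simp only [Sum.elim_inr, h, if_true, Sum.inr.injEq, Prod.mk.injEq]
      omega
  right_inv := by
    rintro ⟨x, y⟩
    by_cases h : (x + y) % 2 = 0
    · simp only [h, if_true, Sum.elim_inr, Prod.mk.injEq]
      omega
    · simp only [h, if_false, Sum.elim_inl, Prod.mk.injEq]
      omega

lemma hasSum_sign_siteTerm {τ : ℂ} (hτ : 0 < τ.im) (a b : ZMod 2) {s : ℂ} (hs : s ^ 2 = 1) :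
    HasSum (fun m : ℤ × ℤ => s ^ (m.1 + m.2) * siteTerm τ a b m)
      (thetaMK ((a.val : ℤ) + b.val + 1) 2 τ * thetaMKbar ((a.val : ℤ) - b.val) 2 τ
        + s * (thetaMK ((a.val : ℤ) + b.val - 1) 2 τ
          * thetaMKbar ((a.val : ℤ) - b.val - 2) 2 τ)) := by
  have hs0 : s ≠ 0 := by
    rintro rfl
    norm_num at hs
  have hodd (k : ℤ) : s ^ (2 * k - 1) = s := by
    have : s ^ (2 * k - 1) = (s ^ 2) ^ (k - 1) * s := by
      rw [← zpow_natCast, ← zpow_mul, ← zpow_add_one₀ hs0]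
      congr 1
      push_cast
      ring
    rw [this, hs, one_zpow, one_mul]
  have heven (k : ℤ) : s ^ (2 * k) = 1 := by
    rw [zpow_mul, zpow_ofNat, hs, one_zpow]
  rw [← sumDiffEquiv.hasSum_iff, add_comm]
  refine HasSum.sum ?_ ?_
  · refine ((hasSum_thetaMK_mul_thetaMKbar hτ _ _).mul_left s).congr_fun ?_
    rintro ⟨x, y⟩
    have h : x + y - 1 + (x - y) = 2 * x - 1 := by ring
    simp only [Function.comp_apply, sumDiffEquiv, Equiv.coe_fn_mk, Sum.elim_inl, siteTerm]
    rw [h, hodd]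
    push_cast
    ring_nf
  · refine (hasSum_thetaMK_mul_thetaMKbar hτ _ _).congr_fun ?_
    rintro ⟨x, y⟩
    have h : x + y + (x - y) = 2 * x := by ring
    simp only [Function.comp_apply, sumDiffEquiv, Equiv.coe_fn_mk, Sum.elim_inr, siteTerm]
    rw [h, heven, one_mul]
    push_cast
    ring_nf

lemma hasSum_psiTP2 {τ : ℂ} (hτ : 0 < τ.im) (a b : ZMod 2) :
    HasSum (siteTerm τ a b) (psiTP2 a b τ) := by
  simpa [psiTP2] using hasSum_sign_siteTerm hτ a b (s := 1) (by norm_num)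

/-- The phase of `ψ̃⁻` at the letters `a, b`. -/
def sitePhase (a b : ZMod 2) : ℂ :=
  Complex.exp (Real.pi * Complex.I * (((a.val : ℝ) + 1 / 2) * ((b.val : ℝ) + 1 / 2)))

lemma hasSum_psiTM2 {τ : ℂ} (hτ : 0 < τ.im) (a b : ZMod 2) :
    HasSum (fun m : ℤ × ℤ => sitePhase a b * ((-1) ^ (m.1 + m.2) * siteTerm τ a b m))
      (psiTM2 a b τ) := by
  have h := (hasSum_sign_siteTerm hτ a b (s := -1) (by norm_num)).mul_left (sitePhase a b)
  rwa [neg_one_mul, ← sub_eq_add_neg] at h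

lemma hasSum_pi_prod {κ : Type*} : ∀ {n : ℕ} {f : Fin n → κ → ℂ} {g : Fin n → ℂ},
    (∀ i, HasSum (f i) (g i)) → HasSum (fun m : Fin n → κ => ∏ i, f i (m i)) (∏ i, g i)
  | 0, _, _, _ => by simp
  | n + 1, f, g, h => by
    rw [← (Fin.consEquiv fun _ : Fin (n + 1) => κ).hasSum_iff, Fin.prod_univ_succ]
    have h' := hasSum_pi_prod fun i => h (Fin.succ i)
    have hs := summable_mul_of_summable_norm (h 0).summable.norm h'.summable.norm
    refine ((h 0).mul h' hs).congr_fun ?_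
    rintro ⟨x, m⟩
    simp [Fin.consEquiv, Fin.prod_univ_succ]

lemma hasSum_cwe {n : ℕ} (C : Set (Fin n ⊕ Fin n → ZMod 2)) {f : ZMod 2 → ZMod 2 → ℤ × ℤ → ℂ}
    {x : ZMod 2 → ZMod 2 → ℂ} (h : ∀ a b, HasSum (f a b) (x a b)) :
    HasSum (fun p : C × (Fin n → ℤ × ℤ) =>
      ∏ i, f (p.1.1 (Sum.inl i)) (p.1.1 (Sum.inr i)) (p.2 i)) (cwe C x) := by
  have hc (c : C) := hasSum_pi_prod fun i => h (c.1 (Sum.inl i)) (c.1 (Sum.inr i))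
  have hs : Summable (fun p : C × (Fin n → ℤ × ℤ) =>
      ∏ i, f (p.1.1 (Sum.inl i)) (p.1.1 (Sum.inr i)) (p.2 i)) := by
    refine Summable.of_norm ((summable_prod_of_nonneg fun _ => norm_nonneg _).2
      ⟨fun c => (hc c).summable.norm, Summable.of_finite⟩)
  have := hs.tsum_prod
  rw [cwe, ← tsum_congr fun c => (hc c).tsum_eq, ← this]
  exact hs.hasSum

/-- The point `(c̃ + 2m)/√2` of the Construction A lattice. -/
def latticePoint {n : ℕ} (c : Fin n ⊕ Fin n → ZMod 2) (m : Fin n → ℤ × ℤ) :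
    Fin n ⊕ Fin n → ℝ :=
  fun i => (liftR c i + (2 : ℕ) * (Sum.elim (fun i => (m i).1) (fun i => (m i).2) i : ℤ)) /
    Real.sqrt (2 : ℕ)

lemma constrA_two_eq_range {n : ℕ} (C : Set (Fin n ⊕ Fin n → ZMod 2)) :
    constrA 2 C = Set.range fun p : C × (Fin n → ℤ × ℤ) => latticePoint p.1.1 p.2 := by
  ext x
  constructor
  · rintro ⟨c, hc, m, rfl⟩
    refine ⟨(⟨c, hc⟩, fun i => (m (Sum.inl i), m (Sum.inr i))), ?_⟩
    funext i
    cases i <;> rfl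
  · rintro ⟨p, rfl⟩
    exact ⟨p.1.1, p.1.2, _, rfl⟩

lemma latticePoint_injective {n : ℕ} (C : Set (Fin n ⊕ Fin n → ZMod 2)) :
    Function.Injective fun p : C × (Fin n → ℤ × ℤ) => latticePoint p.1.1 p.2 := by
  have key : ∀ (a b : ZMod 2) (x y : ℤ),
      ((a.val : ℝ) + (2 : ℕ) * (x : ℝ)) / Real.sqrt (2 : ℕ)
        = ((b.val : ℝ) + (2 : ℕ) * (y : ℝ)) / Real.sqrt (2 : ℕ) → a = b ∧ x = y := by
    intro a b x y h
    have h0 : Real.sqrt (2 : ℕ) ≠ 0 := by positivity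
    rw [div_left_inj' h0] at h
    have h' : (a.val : ℤ) + 2 * x = b.val + 2 * y := by exact_mod_cast h
    have ha := a.val_lt
    have hb := b.val_lt
    refine ⟨ZMod.val_injective 2 ?_, ?_⟩ <;> omega
  rintro ⟨⟨c, hc⟩, m⟩ ⟨⟨c', hc'⟩, m'⟩ h
  have hk (i) := key _ _ _ _ (congrFun h i)
  obtain rfl : c = c' := funext fun i => (hk i).1
  obtain rfl : m = m' := funext fun i => Prod.ext (hk (Sum.inl i)).2 (hk (Sum.inr i)).2
  rfl

/-- The integer `χ ⊙ λ` for `λ = (c̃ + 2m)/√2`, where `c̃` has even total weight. -/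
def chiPairing {n : ℕ} (c : Fin n ⊕ Fin n → ZMod 2) (m : Fin n → ℤ × ℤ) : ℤ :=
  (∑ i, (((c (Sum.inl i)).val : ℤ) + (c (Sum.inr i)).val)) / 2 + ∑ i, ((m i).1 + (m i).2)

lemma lorR_latticePoint {n : ℕ} {c : Fin n ⊕ Fin n → ZMod 2}
    (hc : (2 : ℤ) ∣ ∑ i, (((c (Sum.inl i)).val : ℤ) + (c (Sum.inr i)).val))
    (m : Fin n → ℤ × ℤ) :
    lorR (fun _ => (Real.sqrt 2)⁻¹) (latticePoint c m) = chiPairing c m := by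
  obtain ⟨k, hk⟩ := hc
  have h2 : Real.sqrt 2 * Real.sqrt 2 = 2 := Real.mul_self_sqrt (by norm_num)
  have hk' : ∑ i, (((c (Sum.inl i)).val : ℝ) + (c (Sum.inr i)).val) = 2 * k := by
    exact_mod_cast hk
  rw [chiPairing, hk, Int.mul_ediv_cancel_left _ two_ne_zero]
  have : lorR (fun _ => (Real.sqrt 2)⁻¹) (latticePoint c m)
      = (∑ i, (((c (Sum.inl i)).val : ℝ) + (c (Sum.inr i)).val)) / 2
        + ∑ i, (((m i).1 : ℝ) + (m i).2) := by
    rw [lorR, Finset.sum_div, ← Finset.sum_add_distrib]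
    refine Finset.sum_congr rfl fun i _ => ?_
    simp only [latticePoint, liftR, Sum.elim_inl, Sum.elim_inr, Nat.cast_ofNat]
    field_simp
    rw [Real.sq_sqrt (by norm_num)]
    ring
  rw [this, hk']
  push_cast
  ring

lemma two_dvd_sum_val {n : ℕ} {C : Set (Fin n ⊕ Fin n → ZMod 2)} (hde : isDoublyEven C)
    (hf4 : isF4Even C) {c : Fin n ⊕ Fin n → ZMod 2} (hc : c ∈ C) :
    (2 : ℤ) ∣ ∑ i, ((c (Sum.inl i)).val : ℤ) * (c (Sum.inr i)).val ∧
      (2 : ℤ) ∣ ∑ i, (((c (Sum.inl i)).val : ℤ) + (c (Sum.inr i)).val) := by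
  have h1 := hde c hc
  have h2 := hf4 c hc
  have e1 : ∑ i : Fin n,
      (((c (Sum.inl i)).val : ℤ) * ((c (Sum.inr i)).val : ℤ)
      + ((c (Sum.inr i)).val : ℤ) * ((c (Sum.inl i)).val : ℤ))
      = 2 * ∑ i, ((c (Sum.inl i)).val : ℤ) * (c (Sum.inr i)).val := by
    rw [Finset.mul_sum]
    exact Finset.sum_congr rfl fun i _ => by ring
  have hsq (a : ZMod 2) : (a.val : ℤ) * a.val = a.val := by
    revert a
    decide
  simp only [hsq] at h2
  rw [Finset.sum_sub_distrib] at h2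
  rw [e1] at h1
  omega

lemma prod_sitePhase {n : ℕ} (hn4 : 4 ∣ n) {c : Fin n ⊕ Fin n → ZMod 2}
    (h1 : (2 : ℤ) ∣ ∑ i, ((c (Sum.inl i)).val : ℤ) * (c (Sum.inr i)).val)
    (h2 : (2 : ℤ) ∣ ∑ i, (((c (Sum.inl i)).val : ℤ) + (c (Sum.inr i)).val)) :
    ∏ i, sitePhase (c (Sum.inl i)) (c (Sum.inr i))
      = (-1) ^ (n / 4) * (-1) ^ ((∑ i, (((c (Sum.inl i)).val : ℤ) + (c (Sum.inr i)).val)) / 2) := by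
  obtain ⟨k, hk⟩ := h1
  obtain ⟨l, hl⟩ := h2
  obtain ⟨r, rfl⟩ := hn4
  have hk' : ∑ i, ((c (Sum.inl i)).val : ℂ) * (c (Sum.inr i)).val = 2 * k := by exact_mod_cast hk
  have hl' : ∑ i, (((c (Sum.inl i)).val : ℂ) + (c (Sum.inr i)).val) = 2 * l := by
    exact_mod_cast hl
  rw [hl, Int.mul_ediv_cancel_left _ two_ne_zero, Nat.mul_div_cancel_left _ (by norm_num)]
  simp only [sitePhase]
  rw [← Complex.exp_sum, ← Finset.mul_sum]
  have : ∑ i, (((((c (Sum.inl i)).val : ℝ) : ℂ) + 1 / 2) * (((c (Sum.inr i)).val : ℝ) + 1 / 2))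
      = ∑ i, ((c (Sum.inl i)).val : ℂ) * (c (Sum.inr i)).val
        + (∑ i, (((c (Sum.inl i)).val : ℂ) + (c (Sum.inr i)).val)) / 2
        + ∑ _i : Fin (4 * r), (1 / 4 : ℂ) := by
    rw [Finset.sum_div, ← Finset.sum_add_distrib, ← Finset.sum_add_distrib]
    refine Finset.sum_congr rfl fun i _ => ?_
    push_cast
    ring
  rw [this, hk', hl', Finset.sum_const, Finset.card_univ, Fintype.card_fin, nsmul_eq_mul]
  have e : (Real.pi : ℂ) * Complex.I * (2 * k + 2 * l / 2 + ((4 * r : ℕ) : ℂ) * (1 / 4))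
      = k * (2 * Real.pi * Complex.I) + (r * (Real.pi * Complex.I) + l * (Real.pi * Complex.I)) := by
    push_cast
    ring
  rw [e, Complex.exp_add, Complex.exp_int_mul_two_pi_mul_I, Complex.exp_add, Complex.exp_nat_mul,
    Complex.exp_int_mul, Complex.exp_pi_mul_I, one_mul]

lemma qpow_mul_qbarpow_latticePoint_add {n : ℕ} (τ : ℂ) (c : Fin n ⊕ Fin n → ZMod 2)
    (m : Fin n → ℤ × ℤ) {l : Fin n ⊕ Fin n → ℝ}
    (hl : l = latticePoint c m + (2 : ℝ)⁻¹ • fun _ => (Real.sqrt 2)⁻¹) :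
    qpow τ ((∑ i : Fin n, (l (Sum.inl i) + l (Sum.inr i)) ^ 2) / 4) *
        qbarpow τ ((∑ i : Fin n, (l (Sum.inl i) - l (Sum.inr i)) ^ 2) / 4)
      = ∏ i, siteTerm τ (c (Sum.inl i)) (c (Sum.inr i)) (m i) := by
  rw [Finset.sum_div, Finset.sum_div, qpow_sum, qbarpow_sum, ← Finset.prod_mul_distrib]
  refine Finset.prod_congr rfl fun i _ => ?_
  have h2 : Real.sqrt 2 ^ 2 = 2 := Real.sq_sqrt (by norm_num)
  rw [siteTerm, hl]
  simp only [latticePoint, liftR, Sum.elim_inl, Sum.elim_inr, Nat.cast_ofNat, Pi.add_apply,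
    Pi.smul_apply, smul_eq_mul]
  congr 2
  · field_simp
    rw [h2]
    ring
  · field_simp
    rw [h2]
    ring

/-- The theta function of the `δ`-shift of the part of `Λ(𝒞)` on which `χ ⊙ λ ≡ e mod 2`. -/
lemma thetaSet_shiftSet_graded {n : ℕ} (hn4 : 4 ∣ n) {C : Set (Fin n ⊕ Fin n → ZMod 2)}
    (hde : isDoublyEven C) (hf4 : isF4Even C) {τ : ℂ} (hτ : 0 < τ.im) (e : ℤ)
    {S : Set (Fin n ⊕ Fin n → ℝ)}
    (hS : S = shiftSet {l ∈ constrA 2 C | ∃ k : ℤ, lorR (fun _ => (Real.sqrt 2)⁻¹) l = 2 * k + e}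
      ((2 : ℝ)⁻¹ • fun _ => (Real.sqrt 2)⁻¹)) :
    thetaSet S τ = (cwe C (fun a b => psiTP2 a b τ)
      + (-1) ^ (n / 4) * (-1) ^ e * cwe C (fun a b => psiTM2 a b τ)) / 2 := by
  set δ : Fin n ⊕ Fin n → ℝ := (2 : ℝ)⁻¹ • fun _ => (Real.sqrt 2)⁻¹
  set Φ : C × (Fin n → ℤ × ℤ) → Fin n ⊕ Fin n → ℝ := fun p => latticePoint p.1.1 p.2 + δ
  set T : Set (C × (Fin n → ℤ × ℤ)) := {p | Even (chiPairing p.1.1 p.2 + e)}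
  have hΦi : Function.Injective Φ := fun p q h =>
    latticePoint_injective C (add_right_cancel h)
  have hST : S = Φ '' T := by
    rw [hS, constrA_two_eq_range]
    ext x
    constructor
    · rintro ⟨_, ⟨⟨p, rfl⟩, k, hk⟩, rfl⟩
      refine ⟨p, ?_, rfl⟩
      rw [lorR_latticePoint (two_dvd_sum_val hde hf4 p.1.2).2] at hk
      have hk' : chiPairing p.1.1 p.2 = 2 * k + e := by exact_mod_cast hk
      exact ⟨k + e, by rw [hk']; ring⟩
    · rintro ⟨p, ⟨k, hk⟩, rfl⟩
      refine ⟨_, ⟨⟨p, rfl⟩, k - e, ?_⟩, rfl⟩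
      rw [lorR_latticePoint (two_dvd_sum_val hde hf4 p.1.2).2]
      have hk' : chiPairing p.1.1 p.2 = 2 * (k - e) + e := by linarith
      exact_mod_cast hk'
  have hP := hasSum_cwe C fun a b => hasSum_psiTP2 hτ a b
  have hM := hasSum_cwe C fun a b => hasSum_psiTM2 hτ a b
  have hsum := (hP.add (hM.mul_left ((-1) ^ (n / 4) * (-1) ^ e))).div_const 2
  rw [thetaSet, hST, tsum_image (fun l : Fin n ⊕ Fin n → ℝ =>
    qpow τ ((∑ i : Fin n, (l (Sum.inl i) + l (Sum.inr i)) ^ 2) / 4) *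
      qbarpow τ ((∑ i : Fin n, (l (Sum.inl i) - l (Sum.inr i)) ^ 2) / 4)) hΦi.injOn,
    tsum_congr fun p : T => qpow_mul_qbarpow_latticePoint_add τ p.1.1.1 p.1.2 rfl,
    tsum_subtype T fun p =>
      ∏ i, siteTerm τ (p.1.1 (Sum.inl i)) (p.1.1 (Sum.inr i)) (p.2 i), ← hsum.tsum_eq]
  refine tsum_congr fun p => ?_
  have hp := two_dvd_sum_val hde hf4 p.1.2
  have hsign : (∏ i, sitePhase (p.1.1 (Sum.inl i)) (p.1.1 (Sum.inr i))) *
      ∏ i, (-1 : ℂ) ^ ((p.2 i).1 + (p.2 i).2)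
        = (-1) ^ (n / 4) * (-1) ^ chiPairing p.1.1 p.2 := by
    have hz (s : Finset (Fin n)) (g : Fin n → ℤ) :
        ∏ i ∈ s, (-1 : ℂ) ^ g i = (-1) ^ ∑ i ∈ s, g i := by
      induction s using Finset.cons_induction with
      | empty => simp
      | cons a s ha ih =>
        rw [Finset.prod_cons, Finset.sum_cons, ih, zpow_add₀ (by norm_num)]
    rw [prod_sitePhase hn4 hp.1 hp.2, hz, chiPairing, zpow_add₀ (by norm_num), mul_assoc]
  have hsq : ((-1 : ℂ) ^ (n / 4)) * (-1) ^ (n / 4) = 1 := by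
    rw [← mul_pow]
    norm_num
  have hcomb : (-1 : ℂ) ^ (n / 4) * (-1) ^ e *
      ∏ i, (sitePhase (p.1.1 (Sum.inl i)) (p.1.1 (Sum.inr i)) *
        ((-1) ^ ((p.2 i).1 + (p.2 i).2) *
          siteTerm τ (p.1.1 (Sum.inl i)) (p.1.1 (Sum.inr i)) (p.2 i)))
      = (-1) ^ (chiPairing p.1.1 p.2 + e) *
        ∏ i, siteTerm τ (p.1.1 (Sum.inl i)) (p.1.1 (Sum.inr i)) (p.2 i) := by
    rw [Finset.prod_mul_distrib, Finset.prod_mul_distrib, ← mul_assoc (∏ i, sitePhase _ _), hsign,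
      zpow_add₀ (by norm_num)]
    linear_combination ((-1 : ℂ) ^ e * (-1) ^ chiPairing p.1.1 p.2 *
      ∏ i, siteTerm τ (p.1.1 (Sum.inl i)) (p.1.1 (Sum.inr i)) (p.2 i)) * hsq
  rw [hcomb]
  by_cases hpT : Even (chiPairing p.1.1 p.2 + e)
  · rw [Set.indicator_of_mem (show p ∈ T from hpT), hpT.neg_one_zpow, one_mul, add_self_div_two]
  · rw [Set.indicator_of_notMem (show p ∉ T from hpT),
      (Int.not_even_iff_odd.1 hpT).neg_one_zpow]
    ring

/-- Let `𝒞 ⊆ (ℤ/2)^{2n}` be a doubly-even self-dual F₄-even code with `n ∈ 4ℤ`,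
`χ := (1/√2)·1_{2n}`, `δ := χ/2`, and `Λ₀, Λ₁` the `Z₂`-graded parts of `Λ(𝒞)`; set
`Λ₂ := Λ₁ + δ`, `Λ₃ := Λ₀ + δ` if `n ∈ 8ℤ`, and `Λ₂ := Λ₀ + δ`, `Λ₃ := Λ₁ + δ` if
`n ∈ 8ℤ+4`. Then for every `τ` in the upper half-plane,
`Θ_{Λ₂}(τ) = ½[W_𝒞({ψ̃⁺}) − W_𝒞({ψ̃⁻})]` and `Θ_{Λ₃}(τ) = ½[W_𝒞({ψ̃⁺}) + W_𝒞({ψ̃⁻})]`. -/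
theorem statement17 {n : ℕ} (hn : 1 ≤ n) (hn4 : 4 ∣ n)
    (C : Submodule (ZMod 2) (Fin n ⊕ Fin n → ZMod 2))
    (hde : isDoublyEven (C : Set (Fin n ⊕ Fin n → ZMod 2)))
    (hsd : (C : Set (Fin n ⊕ Fin n → ZMod 2)) = {v | ∀ c ∈ C, lorZmod v c = 0})
    (hf4 : isF4Even (C : Set (Fin n ⊕ Fin n → ZMod 2)))
    (χ δ : Fin n ⊕ Fin n → ℝ)
    (hχ : χ = fun _ => (Real.sqrt 2)⁻¹) (hδ : δ = (2 : ℝ)⁻¹ • χ)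
    (Λ₂ Λ₃ : Set (Fin n ⊕ Fin n → ℝ))
    (hcase0 : n % 8 = 0 →
      Λ₂ = shiftSet (lam1 (constrA 2 (C : Set (Fin n ⊕ Fin n → ZMod 2))) χ) δ ∧
      Λ₃ = shiftSet (lam0 (constrA 2 (C : Set (Fin n ⊕ Fin n → ZMod 2))) χ) δ)
    (hcase4 : n % 8 = 4 →
      Λ₂ = shiftSet (lam0 (constrA 2 (C : Set (Fin n ⊕ Fin n → ZMod 2))) χ) δ ∧
      Λ₃ = shiftSet (lam1 (constrA 2 (C : Set (Fin n ⊕ Fin n → ZMod 2))) χ) δ)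
    (τ : ℂ) (hτ : 0 < τ.im) :
    thetaSet Λ₂ τ =
        (cwe (C : Set (Fin n ⊕ Fin n → ZMod 2)) (fun a b => psiTP2 a b τ)
          - cwe (C : Set (Fin n ⊕ Fin n → ZMod 2)) (fun a b => psiTM2 a b τ)) / 2 ∧
      thetaSet Λ₃ τ =
        (cwe (C : Set (Fin n ⊕ Fin n → ZMod 2)) (fun a b => psiTP2 a b τ)
          + cwe (C : Set (Fin n ⊕ Fin n → ZMod 2)) (fun a b => psiTM2 a b τ)) / 2 := by
  subst hχ hδ
  have h0 := fun S hS => thetaSet_shiftSet_graded hn4 hde hf4 hτ 0 (S := S) hS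
  have h1 := fun S hS => thetaSet_shiftSet_graded hn4 hde hf4 hτ 1 (S := S) hS
  simp only [Int.cast_zero, add_zero, zpow_zero, mul_one] at h0
  simp only [Int.cast_one, zpow_one] at h1
  have h8 : n % 8 = 0 ∨ n % 8 = 4 := by omega
  rcases h8 with h8 | h8
  · obtain ⟨e2, e3⟩ := hcase0 h8
    have hs : (-1 : ℂ) ^ (n / 4) = 1 := Even.neg_one_pow ⟨n / 8, by omega⟩
    rw [h1 Λ₂ e2, h0 Λ₃ e3, hs]
    constructor <;> ring
  · obtain ⟨e2, e3⟩ := hcase4 h8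
    have hs : (-1 : ℂ) ^ (n / 4) = -1 := Odd.neg_one_pow ⟨n / 8, by omega⟩
    rw [h0 Λ₂ e2, h1 Λ₃ e3, hs]
    constructor <;> ring
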